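/- For ρ = 1/2, the operator θ_{1/2} : Λ_{1/2} → Λ_{1/2} is injective and its cokernel has complex dimension 3(k′+1); that is, H^i_dR(𝔾_m, L ⊗ Sym^k Ai) has dimension 3(k′+1) for i = 1 and vanishes for i = 0. -/

import Mathlib

/-- The operator `z·d/dz` on the space `ℤ →₀ ℂ` of Laurent polynomials in `z`
(a Laurent polynomial being recorded by its finitely supported coefficient function,
`single n c` standing for `c·zⁿ`): it multiplies the coefficient of `zⁿ` by `n`. -/
noncomputable def zdz : (ℤ →₀ ℂ) →ₗ[ℂ] (ℤ →₀ ℂ) :=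
  Finsupp.lsum ℂ fun n => (n : ℂ) • Finsupp.lsingle n

/-- Multiplication by `z^m` on Laurent polynomials. -/
noncomputable def shiftT (m : ℤ) : (ℤ →₀ ℂ) →ₗ[ℂ] (ℤ →₀ ℂ) :=
  Finsupp.lmapDomain ℂ ℂ (· + m)

/-- The operator `z∂_z` on `Λ_ρ = ⊕_{a=0}^k ℂ[z,z⁻¹]·u_a`, the module of global sections over
`𝔾_m` of `V_ρ` (where `V_0 = Sym^k Ai` and `V_{1/2} = L ⊗ Sym^k Ai`):
`θ_ρ(p·u_a) = z·p′·u_a + p·(ρ·u_a + (k−a)·z·u_{a+1} + a·z²·u_{a−1})`. -/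
noncomputable def theta (k : ℕ) (ρ : ℂ) :
    (Fin (k + 1) → (ℤ →₀ ℂ)) →ₗ[ℂ] (Fin (k + 1) → (ℤ →₀ ℂ)) :=
  LinearMap.pi fun b =>
    zdz.comp (LinearMap.proj b) + ρ • LinearMap.proj b
    + (if 1 ≤ (b : ℕ) then
        ((k - ((b : ℕ) - 1) : ℕ) : ℂ) •
          (shiftT 1).comp (LinearMap.proj ⟨(b : ℕ) - 1, by have := b.isLt; omega⟩)
      else 0)
    + (if h : (b : ℕ) + 1 ≤ k then
        (((b : ℕ) + 1 : ℕ) : ℂ) •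
          (shiftT 2).comp (LinearMap.proj ⟨(b : ℕ) + 1, by omega⟩)
      else 0)

section BandOperator

variable {f : (ℤ →₀ ℂ) →ₗ[ℂ] (ℤ →₀ ℂ)} {L H : ℤ}

lemma map_apply_eq_sum (f : (ℤ →₀ ℂ) →ₗ[ℂ] (ℤ →₀ ℂ)) (x : ℤ →₀ ℂ) (n : ℤ) :
    f x n = ∑ m ∈ x.support, x m * f (Finsupp.single m 1) n := by
  conv_lhs => rw [← Finsupp.sum_single x]
  rw [Finsupp.sum, map_sum, Finsupp.finsetSum_apply]
  refine Finset.sum_congr rfl fun m _ => ?_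
  have : Finsupp.single m (x m) = x m • Finsupp.single m (1 : ℂ) := by simp
  rw [this, map_smul, Finsupp.smul_apply, smul_eq_mul]

/-- The extreme coefficients of the image of `x` under a band operator come from the extreme
coefficients of `x`; here at the low end. -/
lemma map_apply_low (hlow : ∀ m n, n < m - L → f (Finsupp.single m 1) n = 0)
    {x : ℤ →₀ ℂ} (hx : x.support.Nonempty) :
    f x (x.support.min' hx - L) = x (x.support.min' hx) *
      f (Finsupp.single (x.support.min' hx) 1) (x.support.min' hx - L) := by
  rw [map_apply_eq_sum]
  refine Finset.sum_eq_single_of_mem _ (Finset.min'_mem _ _) fun m hm hne => ?_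
  have := lt_of_le_of_ne (Finset.min'_le _ _ hm) hne.symm
  rw [hlow m _ (by omega), mul_zero]

lemma map_apply_high (hhigh : ∀ m n, m + H < n → f (Finsupp.single m 1) n = 0)
    {x : ℤ →₀ ℂ} (hx : x.support.Nonempty) :
    f x (x.support.max' hx + H) = x (x.support.max' hx) *
      f (Finsupp.single (x.support.max' hx) 1) (x.support.max' hx + H) := by
  rw [map_apply_eq_sum]
  refine Finset.sum_eq_single_of_mem _ (Finset.max'_mem _ _) fun m hm hne => ?_
  have := lt_of_le_of_ne (Finset.le_max' _ _ hm) hne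
  rw [hhigh m _ (by omega), mul_zero]

lemma ker_eq_bot_of_band (hlow : ∀ m n, n < m - L → f (Finsupp.single m 1) n = 0)
    (hlow' : ∀ m, f (Finsupp.single m 1) (m - L) ≠ 0) : LinearMap.ker f = ⊥ := by
  refine (Submodule.eq_bot_iff _).2 fun x hx => ?_
  by_contra hne
  have hs := Finsupp.support_nonempty_iff.2 hne
  have h := map_apply_low hlow hs
  rw [LinearMap.mem_ker.1 hx, Finsupp.zero_apply, eq_comm, mul_eq_zero] at h
  exact h.elim (Finsupp.mem_support_iff.1 (Finset.min'_mem _ hs)) (hlow' _)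

/-- If `y` has nonzero coefficient at `j` and lies in `S`, and all monomials occurring in `y` other
than `z ^ j` lie in `S`, then so does `z ^ j`. -/
lemma single_mem_of_mem {S : Submodule ℂ (ℤ →₀ ℂ)} {y : ℤ →₀ ℂ} {j : ℤ} (hy : y ∈ S)
    (hj : y j ≠ 0) (h : ∀ i, y i ≠ 0 → i ≠ j → Finsupp.single i 1 ∈ S) :
    Finsupp.single j (1 : ℂ) ∈ S := by
  have herase : y.erase j ∈ S := by
    rw [← Finsupp.sum_single (y.erase j)]
    refine S.sum_mem fun i hi => ?_
    rw [Finsupp.support_erase, Finset.mem_erase, Finsupp.mem_support_iff] at hi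
    have := S.smul_mem ((y.erase j) i) (h i hi.2 hi.1)
    simpa using this
  have hsub := S.smul_mem (y j)⁻¹ (S.sub_mem hy herase)
  rw [← Finsupp.single_add_erase j y] at hsub
  simpa [hj] using hsub

/-- For a band operator whose lowest coefficients never vanish and whose highest ones do not vanish
from `M` on, the window `[M - L, M + H)` gives a complement of the range. -/
lemma isCompl_range_of_band (hlow : ∀ m n, n < m - L → f (Finsupp.single m 1) n = 0)
    (hlow' : ∀ m, f (Finsupp.single m 1) (m - L) ≠ 0)
    (hhigh : ∀ m n, m + H < n → f (Finsupp.single m 1) n = 0) {M : ℤ}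
    (hhigh' : ∀ m, M ≤ m → f (Finsupp.single m 1) (m + H) ≠ 0) :
    IsCompl (LinearMap.range f)
      (Finsupp.supported ℂ ℂ (↑(Finset.Ico (M - L) (M + H)) : Set ℤ)) := by
  constructor
  · rw [Submodule.disjoint_def]
    rintro _ ⟨x, rfl⟩ hfx
    by_contra hne
    have hs : x.support.Nonempty :=
      Finsupp.support_nonempty_iff.2 fun h => hne (by rw [h, map_zero])
    have hmem : ∀ n, f x n ≠ 0 → M - L ≤ n ∧ n < M + H := fun n hn => by
      simpa using (Finsupp.mem_supported ℂ _).1 hfx (Finsupp.mem_support_iff.2 hn)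
    have hmin := hmem _ (by
      rw [map_apply_low hlow hs]
      exact mul_ne_zero (Finsupp.mem_support_iff.1 (Finset.min'_mem _ hs)) (hlow' _))
    have hle := Finset.min'_le_max' _ hs
    have hmax := hmem _ (by
      rw [map_apply_high hhigh hs]
      exact mul_ne_zero (Finsupp.mem_support_iff.1 (Finset.max'_mem _ hs))
        (hhigh' _ (by omega)))
    omega
  · set S := LinearMap.range f ⊔
      Finsupp.supported ℂ ℂ (↑(Finset.Ico (M - L) (M + H)) : Set ℤ) with hS
    have hrange : ∀ x, f x ∈ S := fun x =>
      Submodule.mem_sup_left (LinearMap.mem_range_self f x)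
    have hwindow : ∀ j, M - L ≤ j → j < M + H → Finsupp.single j (1 : ℂ) ∈ S := fun j h₁ h₂ =>
      Submodule.mem_sup_right (Finsupp.single_mem_supported ℂ _ (by simp [h₁, h₂]))
    have hband : ∀ m i, f (Finsupp.single m 1) i ≠ 0 → m - L ≤ i ∧ i ≤ m + H := fun m i hi =>
      ⟨not_lt.1 fun h => hi (hlow m i h), not_lt.1 fun h => hi (hhigh m i h)⟩
    have hdown : ∀ d : ℕ, ∀ j, j < M + H → M - L - d ≤ j → Finsupp.single j (1 : ℂ) ∈ S := by
      intro d
      induction d with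
      | zero => exact fun j h₁ h₂ => hwindow j (by simpa using h₂) h₁
      | succ d ih =>
        intro j h₁ h₂
        push_cast at h₂
        by_cases hj : M - L - d ≤ j
        · exact ih j h₁ hj
        refine single_mem_of_mem (hrange (Finsupp.single (j + L) 1))
          (by simpa using hlow' (j + L)) fun i hi hne => ?_
        have := hband _ _ hi
        exact ih i (by omega) (by omega)
    have hup : ∀ d : ℕ, ∀ j, j < M + H + d → Finsupp.single j (1 : ℂ) ∈ S := by
      intro d
      induction d with
      | zero => exact fun j h => hdown (M - L - j).toNat j (by simpa using h) (by omega)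
      | succ d ih =>
        intro j h
        push_cast at h
        by_cases hj : j < M + H + d
        · exact ih j hj
        refine single_mem_of_mem (hrange (Finsupp.single (j - H) 1))
          (by simpa using hhigh' (j - H) (by omega)) fun i hi hne => ?_
        have := hband _ _ hi
        exact ih i (by omega)
    rw [codisjoint_iff, ← hS, eq_top_iff]
    intro x _
    rw [← Finsupp.sum_single x]
    refine S.sum_mem fun i _ => ?_
    simpa using S.smul_mem (x i) (hup (i - (M + H) + 1).toNat i (by omega))

lemma finrank_coker_of_band (hlow : ∀ m n, n < m - L → f (Finsupp.single m 1) n = 0)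
    (hlow' : ∀ m, f (Finsupp.single m 1) (m - L) ≠ 0)
    (hhigh : ∀ m n, m + H < n → f (Finsupp.single m 1) n = 0) {M : ℤ}
    (hhigh' : ∀ m, M ≤ m → f (Finsupp.single m 1) (m + H) ≠ 0) :
    FiniteDimensional ℂ ((ℤ →₀ ℂ) ⧸ LinearMap.range f) ∧
      Module.finrank ℂ ((ℤ →₀ ℂ) ⧸ LinearMap.range f) = (L + H).toNat := by
  let e := (Submodule.quotientEquivOfIsCompl _ _
    (isCompl_range_of_band hlow hlow' hhigh hhigh')).trans (Finsupp.supportedEquivFinsupp _)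
  refine ⟨Module.Finite.equiv e.symm, ?_⟩
  rw [e.finrank_eq, Module.finrank_finsupp_self]
  simp only [Finset.coe_sort_coe, Fintype.card_coe, Int.card_Ico]
  congr 1
  ring

end BandOperator

lemma zdz_apply (p : ℤ →₀ ℂ) (n : ℤ) : zdz p n = n * p n := by
  induction p using Finsupp.induction_linear with
  | zero => simp
  | add p q hp hq => simp [hp, hq, mul_add]
  | single m c =>
    by_cases h : m = n <;> simp [zdz, h]

lemma shiftT_apply (m : ℤ) (p : ℤ →₀ ℂ) (n : ℤ) : shiftT m p n = p (n - m) := by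
  have h := Finsupp.mapDomain_apply (f := fun i : ℤ => i + m) (add_left_injective m) p (n - m)
  simpa [shiftT] using h

lemma shiftT_shiftT (m n : ℤ) (p : ℤ →₀ ℂ) : shiftT m (shiftT n p) = shiftT (m + n) p := by
  ext i
  simp only [shiftT_apply]
  congr 1
  ring

lemma shiftT_zero (p : ℤ →₀ ℂ) : shiftT 0 p = p := by
  ext i
  simp [shiftT_apply]

section Elimination

variable {V : Type*} [AddCommGroup V] [Module ℂ V]

/-- The sequence `x` with `x 0 = p` solving
`(z∂_z + 1/2) x_b + (k - b + 1) z x_{b-1} + (b + 1) z² x_{b+1} = y_b` for all `b`,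
depending linearly on a parameter in `V`. -/
noncomputable def solve (k : ℕ) (y : ℕ → V →ₗ[ℂ] (ℤ →₀ ℂ)) (p : V →ₗ[ℂ] (ℤ →₀ ℂ)) :
    ℕ → V →ₗ[ℂ] (ℤ →₀ ℂ)
  | 0 => p
  | 1 => shiftT (-2) ∘ₗ (y 0 - (zdz ∘ₗ p + (1 / 2 : ℂ) • p))
  | b + 2 => ((b + 2 : ℕ) : ℂ)⁻¹ • shiftT (-2) ∘ₗ
      (y (b + 1) - (zdz ∘ₗ solve k y p (b + 1) + (1 / 2 : ℂ) • solve k y p (b + 1))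
        - ((k - b : ℕ) : ℂ) • shiftT 1 ∘ₗ solve k y p b)

lemma theta_apply_zero {k : ℕ} (hk : 1 ≤ k) (ρ : ℂ) (x : Fin (k + 1) → (ℤ →₀ ℂ)) :
    theta k ρ x ⟨0, by omega⟩ = zdz (x ⟨0, by omega⟩) + ρ • x ⟨0, by omega⟩
      + shiftT 2 (x ⟨1, by omega⟩) := by
  simp [theta, Nat.pos_iff_ne_zero.2 (Nat.one_le_iff_ne_zero.1 hk)]

lemma theta_apply_succ {k : ℕ} (ρ : ℂ) (x : Fin (k + 1) → (ℤ →₀ ℂ)) {b : ℕ} (hb : b + 1 < k) :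
    theta k ρ x ⟨b + 1, by omega⟩ = zdz (x ⟨b + 1, by omega⟩) + ρ • x ⟨b + 1, by omega⟩
      + ((k - b : ℕ) : ℂ) • shiftT 1 (x ⟨b, by omega⟩)
      + ((b + 2 : ℕ) : ℂ) • shiftT 2 (x ⟨b + 2, by omega⟩) := by
  simp [theta, hb, Nat.cast_sub (show b ≤ k by omega), add_assoc, one_add_one_eq_two]

lemma theta_apply_last {b : ℕ} (ρ : ℂ) (x : Fin (b + 2) → (ℤ →₀ ℂ)) :
    theta (b + 1) ρ x ⟨b + 1, by omega⟩ = zdz (x ⟨b + 1, by omega⟩) + ρ • x ⟨b + 1, by omega⟩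
      + shiftT 1 (x ⟨b, by omega⟩) := by
  simp [theta]

variable (k : ℕ) (y : ℕ → V →ₗ[ℂ] (ℤ →₀ ℂ)) (p : V →ₗ[ℂ] (ℤ →₀ ℂ))

lemma shiftT_two_solve_one (v : V) :
    shiftT 2 (solve k y p 1 v) = y 0 v - (zdz (p v) + (1 / 2 : ℂ) • p v) := by
  simp only [solve, LinearMap.comp_apply, LinearMap.sub_apply, LinearMap.add_apply,
    LinearMap.smul_apply, shiftT_shiftT, add_neg_cancel, shiftT_zero]

lemma smul_shiftT_two_solve (b : ℕ) (v : V) :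
    ((b + 2 : ℕ) : ℂ) • shiftT 2 (solve k y p (b + 2) v) =
      y (b + 1) v - (zdz (solve k y p (b + 1) v) + (1 / 2 : ℂ) • solve k y p (b + 1) v)
        - ((k - b : ℕ) : ℂ) • shiftT 1 (solve k y p b v) := by
  have h : ((b + 2 : ℕ) : ℂ) ≠ 0 := by norm_cast
  rw [solve, LinearMap.smul_apply, map_smul, smul_smul, mul_inv_cancel₀ h, one_smul]
  simp only [LinearMap.comp_apply, LinearMap.sub_apply, LinearMap.add_apply,
    LinearMap.smul_apply, shiftT_shiftT, add_neg_cancel, shiftT_zero]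

lemma theta_solve {b : ℕ} (hb : b < k) (v : V) :
    theta k (1 / 2) (fun a => solve k y p a v) ⟨b, by omega⟩ = y b v := by
  rcases b with _ | b
  · rw [theta_apply_zero hb]
    simp only [shiftT_two_solve_one]
    rw [solve]
    abel
  · rw [theta_apply_succ _ _ hb]
    simp only [smul_shiftT_two_solve]
    abel

end Elimination

section Cokernel

variable (k : ℕ)

lemma eq_solve {x : Fin (k + 1) → (ℤ →₀ ℂ)} (hk : 1 ≤ k)
    (hx : ∀ b (hb : b < k), theta k (1 / 2) x ⟨b, by omega⟩ = 0) (b : ℕ) (hb : b < k + 1) :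
    x ⟨b, hb⟩ = solve k 0 LinearMap.id b (x ⟨0, by omega⟩) := by
  have hinj : ∀ p q : ℤ →₀ ℂ, shiftT 2 p = shiftT 2 q → p = q := fun p q h => by
    simpa only [shiftT_shiftT, neg_add_cancel, shiftT_zero] using congrArg (shiftT (-2)) h
  induction b using Nat.twoStepInduction with
  | zero => rfl
  | one =>
    apply hinj
    have h := hx 0 hk
    rw [theta_apply_zero hk] at h
    rw [shiftT_two_solve_one]
    simpa using eq_neg_of_add_eq_zero_right h
  | more b ih₀ ih₁ =>
    apply hinj
    have hne : ((b + 2 : ℕ) : ℂ) ≠ 0 := by norm_cast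
    apply smul_right_injective _ hne
    have h := hx (b + 1) (by omega)
    rw [theta_apply_succ _ _ (by omega)] at h
    simp only [smul_shiftT_two_solve, ← ih₀ (by omega), ← ih₁ (by omega)]
    rw [eq_neg_of_add_eq_zero_right h]
    simp only [Pi.zero_apply, LinearMap.zero_apply]
    abel

/-- The scalar operator obtained from `theta k (1 / 2)` by eliminating all components but the
first one. -/
noncomputable def scalarOp (k : ℕ) : (ℤ →₀ ℂ) →ₗ[ℂ] (ℤ →₀ ℂ) :=
  -(((k + 1 : ℕ) : ℂ) • shiftT 2 ∘ₗ solve k 0 LinearMap.id (k + 1))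

lemma theta_solve_last (hk : 1 ≤ k) (q : ℤ →₀ ℂ) :
    theta k (1 / 2) (fun a => solve k 0 LinearMap.id a q) ⟨k, by omega⟩ = scalarOp k q := by
  obtain ⟨b, rfl⟩ := Nat.exists_eq_add_of_le' hk
  rw [theta_apply_last, scalarOp, LinearMap.neg_apply, LinearMap.smul_apply,
    LinearMap.comp_apply, smul_shiftT_two_solve]
  simp only [Pi.zero_apply, LinearMap.zero_apply, add_tsub_cancel_left, Nat.cast_one, one_smul]
  abel

lemma theta_solve_zero (hk : 1 ≤ k) (q : ℤ →₀ ℂ) :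
    theta k (1 / 2) (fun a => solve k 0 LinearMap.id a q) =
      Pi.single ⟨k, by omega⟩ (scalarOp k q) := by
  ext1 ⟨b, hb⟩
  rcases Nat.lt_succ_iff_lt_or_eq.1 hb with h | rfl
  · rw [theta_solve k _ _ h, Pi.single_eq_of_ne (by simp [h.ne])]
    rfl
  · rw [theta_solve_last _ hk, Pi.single_eq_same]

lemma scalarOp_eq_of_theta_eq_single (hk : 1 ≤ k) {x : Fin (k + 1) → (ℤ →₀ ℂ)} {q : ℤ →₀ ℂ}
    (h : theta k (1 / 2) x = Pi.single ⟨k, by omega⟩ q) :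
    x = (fun a : Fin (k + 1) => solve k 0 LinearMap.id a (x ⟨0, by omega⟩)) ∧
      scalarOp k (x ⟨0, by omega⟩) = q := by
  have hx : x = fun a : Fin (k + 1) => solve k 0 LinearMap.id a (x ⟨0, by omega⟩) := by
    ext1 ⟨b, hb⟩
    refine eq_solve k hk (fun b hb => ?_) b hb
    rw [h, Pi.single_eq_of_ne (by simp [hb.ne])]
  refine ⟨hx, ?_⟩
  rw [← theta_solve_last k hk, ← hx, h, Pi.single_eq_same]

lemma ker_theta_eq_bot (hk : 1 ≤ k) (h : LinearMap.ker (scalarOp k) = ⊥) :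
    LinearMap.ker (theta k (1 / 2)) = ⊥ := by
  refine (Submodule.eq_bot_iff _).2 fun x hx => ?_
  obtain ⟨hx₁, hx₂⟩ := scalarOp_eq_of_theta_eq_single k hk (x := x) (q := 0)
    (by simpa using hx)
  rw [hx₁, LinearMap.ker_eq_bot'.1 h _ hx₂]
  ext1 a
  simp

/-- The cokernels of `scalarOp k` and of `theta k (1 / 2)` agree. -/
noncomputable def cokerEquiv (hk : 1 ≤ k) :
    ((ℤ →₀ ℂ) ⧸ LinearMap.range (scalarOp k)) ≃ₗ[ℂ]
      ((Fin (k + 1) → (ℤ →₀ ℂ)) ⧸ LinearMap.range (theta k (1 / 2))) := by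
  let π : (ℤ →₀ ℂ) →ₗ[ℂ]
      ((Fin (k + 1) → (ℤ →₀ ℂ)) ⧸ LinearMap.range (theta k (1 / 2))) :=
    (LinearMap.range (theta k (1 / 2))).mkQ ∘ₗ
      LinearMap.single ℂ (fun _ : Fin (k + 1) => ℤ →₀ ℂ) ⟨k, by omega⟩
  have hker : LinearMap.range (scalarOp k) = LinearMap.ker π := by
    ext q
    simp only [π, LinearMap.mem_ker, LinearMap.comp_apply, Submodule.mkQ_apply,
      Submodule.Quotient.mk_eq_zero, LinearMap.mem_range, LinearMap.coe_single]
    constructor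
    · rintro ⟨p, rfl⟩
      exact ⟨_, theta_solve_zero k hk p⟩
    · rintro ⟨x, hx⟩
      exact ⟨_, (scalarOp_eq_of_theta_eq_single k hk hx).2⟩
  have hsurj : Function.Surjective π := by
    intro w
    obtain ⟨y, rfl⟩ := Submodule.mkQ_surjective _ w
    let Y : ℕ → (Fin (k + 1) → (ℤ →₀ ℂ)) →ₗ[ℂ] (ℤ →₀ ℂ) := fun b =>
      if hb : b < k + 1 then LinearMap.proj ⟨b, hb⟩ else 0
    let x : Fin (k + 1) → (ℤ →₀ ℂ) := fun a => solve k Y 0 a y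
    refine ⟨(y - theta k (1 / 2) x) ⟨k, by omega⟩, ?_⟩
    refine (Submodule.Quotient.eq _).2 ⟨-x, ?_⟩
    rw [map_neg]
    ext1 ⟨b, hb⟩
    rcases Nat.lt_succ_iff_lt_or_eq.1 hb with h | rfl
    · have : theta k (1 / 2) x ⟨b, hb⟩ = y ⟨b, hb⟩ := by
        rw [theta_solve k Y 0 h y]
        simp only [Y, dif_pos hb, LinearMap.proj_apply]
      simp only [LinearMap.single_apply, Pi.sub_apply, Pi.neg_apply, this]
      simp [Pi.single_eq_of_ne, h.ne]
    · simp
  exact (Submodule.quotEquivOfEq _ _ hker).trans (π.quotKerEquivOfSurjective hsurj)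

end Cokernel

section Coefficients

/-- The coefficient of `z ^ n` in the `b`-th component of the homogeneous solution starting
with `z ^ m`. -/
noncomputable def solveCoeff (k : ℕ) (m : ℤ) : ℕ → ℤ → ℝ
  | 0, n => if n = m then 1 else 0
  | 1, n => -((n + 2 + 1 / 2) * if n + 2 = m then 1 else 0)
  | b + 2, n => -(((n + 2 + 1 / 2) * solveCoeff k m (b + 1) (n + 2)
      + ((k - b : ℕ) : ℝ) * solveCoeff k m b (n + 1)) / ((b + 2 : ℕ) : ℝ))

variable (k : ℕ) (m : ℤ)

lemma solve_single_apply (b : ℕ) (n : ℤ) :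
    solve k 0 LinearMap.id b (Finsupp.single m 1) n = (solveCoeff k m b n : ℂ) := by
  induction b using Nat.twoStepInduction generalizing n with
  | zero => by_cases h : m = n <;> simp [solve, solveCoeff, h, eq_comm (a := n)]
  | one =>
    simp [solve, solveCoeff, shiftT_apply, zdz_apply, Finsupp.single_apply, eq_comm (a := m)]
    split_ifs <;> simp
  | more b ih₀ ih₁ =>
    simp only [solve, solveCoeff, LinearMap.smul_apply, LinearMap.comp_apply,
      LinearMap.sub_apply, LinearMap.add_apply, Pi.zero_apply, LinearMap.zero_apply,
      Finsupp.smul_apply, Finsupp.sub_apply, Finsupp.add_apply, Finsupp.zero_apply,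
      shiftT_apply, zdz_apply, ih₀, ih₁, smul_eq_mul]
    have h : n - -2 - 1 = n + 1 := by ring
    rw [h, sub_neg_eq_add]
    push_cast
    ring

variable {m}

lemma solveCoeff_eq_zero_of_lt (b : ℕ) (n : ℤ) (h : n < m - 2 * b) :
    solveCoeff k m b n = 0 := by
  induction b using Nat.twoStepInduction generalizing n with
  | zero => simp at h; simp [solveCoeff, h.ne]
  | one => push_cast at h; simp [solveCoeff, show n + 2 ≠ m by omega]
  | more b ih₀ ih₁ =>
    push_cast at h
    simp [solveCoeff, ih₀ (n + 1) (by omega), ih₁ (n + 2) (by push_cast; omega)]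

lemma solveCoeff_low_ne_zero (b : ℕ) : solveCoeff k m b (m - 2 * b) ≠ 0 := by
  have hhalf : ∀ i : ℤ, (i : ℝ) + 1 / 2 ≠ 0 := fun i h => by
    have h2 : ((2 * i + 1 : ℤ) : ℝ) = 0 := by push_cast; linarith
    have h3 : 2 * i + 1 = 0 := by exact_mod_cast h2
    omega
  induction b using Nat.twoStepInduction with
  | zero => simp [solveCoeff]
  | one =>
    have h : ((m - 2 : ℤ) : ℝ) + 2 + 1 / 2 = m + 1 / 2 := by push_cast; ring
    simpa only [solveCoeff, Nat.cast_one, mul_one, sub_add_cancel, if_true, h, Ne, neg_eq_zero]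
      using hhalf m
  | more b _ ih =>
    have h : m - 2 * ((b + 2 : ℕ) : ℤ) + 2 = m - 2 * ((b + 1 : ℕ) : ℤ) := by push_cast; ring
    have hhalf' := hhalf (m - 2 * ((b + 2 : ℕ) : ℤ) + 2)
    rw [solveCoeff, solveCoeff_eq_zero_of_lt k b _ (by push_cast; omega), h, mul_zero, add_zero]
    refine neg_ne_zero.2 (div_ne_zero (mul_ne_zero ?_ ih) (by positivity))
    exact_mod_cast hhalf'

lemma solveCoeff_eq_zero_of_gt (s : ℕ) :
    (∀ n, m - s < n → solveCoeff k m (2 * s) n = 0) ∧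
      ∀ n, m - s - 2 < n → solveCoeff k m (2 * s + 1) n = 0 := by
  induction s with
  | zero =>
    refine ⟨fun n h => ?_, fun n h => ?_⟩
    · simp at h
      simp [solveCoeff, h.ne']
    · simp at h
      simp [solveCoeff, show n + 2 ≠ m by omega]
  | succ s ih =>
    have heven : ∀ n, m - (s + 1 : ℕ) < n → solveCoeff k m (2 * s + 2) n = 0 := fun n h => by
      push_cast at h
      rw [solveCoeff, ih.1 _ (by omega), ih.2 _ (by omega)]
      simp
    refine ⟨heven, fun n h => ?_⟩
    push_cast at h
    rw [show 2 * (s + 1) + 1 = 2 * s + 1 + 2 by ring, solveCoeff, heven _ (by push_cast; omega),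
      ih.2 _ (by omega)]
    simp

lemma solveCoeff_high_pos (hm : (k : ℤ) ≤ m) (s : ℕ) :
    (2 * s ≤ k + 1 → 0 < (-1) ^ s * solveCoeff k m (2 * s) (m - s)) ∧
      (2 * s ≤ k → 0 < (-1) ^ (s + 1) * solveCoeff k m (2 * s + 1) (m - s - 2)) := by
  induction s with
  | zero =>
    have hm' : (0 : ℝ) ≤ m := by exact_mod_cast (by omega : (0 : ℤ) ≤ m)
    refine ⟨fun _ => by simp [solveCoeff], fun _ => ?_⟩
    simp [solveCoeff]
    linarith
  | succ s ih =>
    have heven : 2 * (s + 1) ≤ k + 1 →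
        0 < (-1) ^ (s + 1) * solveCoeff k m (2 * s + 2) (m - (s + 1 : ℕ)) := fun h => by
      have hpos := ih.1 (by omega)
      have hk : (0 : ℝ) < (k - 2 * s : ℕ) := by exact_mod_cast (by omega : 0 < k - 2 * s)
      rw [solveCoeff, (solveCoeff_eq_zero_of_gt k s).2 _ (by push_cast; omega),
        show m - ((s + 1 : ℕ) : ℤ) + 1 = m - s by push_cast; ring]
      have := div_pos (mul_pos hk hpos) (by positivity : (0 : ℝ) < (2 * s + 2 : ℕ))
      refine this.trans_eq ?_
      ring
    refine ⟨heven, fun h => ?_⟩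
    have hpos₁ := heven (by omega)
    have hpos₂ := ih.2 (by omega)
    have hk : (0 : ℝ) ≤ (k - (2 * s + 1) : ℕ) := by positivity
    have hm' : (0 : ℝ) < ((m - (s + 1 : ℕ) : ℤ) : ℝ) + 1 / 2 := by
      have : (0 : ℝ) ≤ ((m - (s + 1 : ℕ) : ℤ) : ℝ) := by exact_mod_cast (by omega)
      linarith
    rw [show 2 * (s + 1) + 1 = 2 * s + 1 + 2 by ring, solveCoeff,
      show m - ((s + 1 : ℕ) : ℤ) - 2 + 2 = m - (s + 1 : ℕ) by ring,
      show m - ((s + 1 : ℕ) : ℤ) - 2 + 1 = m - s - 2 by push_cast; ring]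
    have := div_pos (add_pos_of_pos_of_nonneg (mul_pos hm' hpos₁) (mul_nonneg hk hpos₂.le))
      (by positivity : (0 : ℝ) < (2 * s + 1 + 2 : ℕ))
    refine this.trans_eq ?_
    push_cast
    ring

variable (m)

lemma scalarOp_single_apply (n : ℤ) :
    scalarOp k (Finsupp.single m 1) n =
      -(((k + 1 : ℕ) : ℂ) * (solveCoeff k m (k + 1) (n - 2) : ℂ)) := by
  simp only [scalarOp, LinearMap.neg_apply, LinearMap.smul_apply, LinearMap.comp_apply,
    Finsupp.neg_apply, Finsupp.smul_apply, shiftT_apply, solve_single_apply, smul_eq_mul]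

lemma scalarOp_single_apply_eq_zero_iff (n : ℤ) :
    scalarOp k (Finsupp.single m 1) n = 0 ↔ solveCoeff k m (k + 1) (n - 2) = 0 := by
  have h : ((k + 1 : ℕ) : ℂ) ≠ 0 := by norm_cast
  rw [scalarOp_single_apply, neg_eq_zero, mul_eq_zero_iff_left h, Complex.ofReal_eq_zero]

lemma scalarOp_single_low (n : ℤ) (h : n < m - 2 * (k : ℤ)) :
    scalarOp k (Finsupp.single m 1) n = 0 :=
  (scalarOp_single_apply_eq_zero_iff k m n).2
    (solveCoeff_eq_zero_of_lt k _ _ (by push_cast; omega))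

lemma scalarOp_single_low_ne_zero :
    scalarOp k (Finsupp.single m 1) (m - 2 * (k : ℤ)) ≠ 0 := by
  rw [Ne, scalarOp_single_apply_eq_zero_iff,
    show m - 2 * (k : ℤ) - 2 = m - 2 * (k + 1 : ℕ) by push_cast; ring]
  exact solveCoeff_low_ne_zero k (k + 1)

/-- The largest amount by which `scalarOp k` raises degrees. -/
def scalarOpHeight (k : ℕ) : ℤ := 3 * (((k - 1) / 2 : ℕ) + 1) - 2 * k

lemma scalarOp_single_high (hk : 1 ≤ k) (n : ℤ) (h : m + scalarOpHeight k < n) :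
    scalarOp k (Finsupp.single m 1) n = 0 := by
  rw [scalarOp_single_apply_eq_zero_iff]
  unfold scalarOpHeight at h
  rcases Nat.even_or_odd' (k + 1) with ⟨s, hs | hs⟩
  · rw [hs]
    exact (solveCoeff_eq_zero_of_gt k s).1 _ (by omega)
  · rw [hs]
    exact (solveCoeff_eq_zero_of_gt k s).2 _ (by omega)

lemma scalarOp_single_high_ne_zero (hk : 1 ≤ k) (hm : (k : ℤ) ≤ m) :
    scalarOp k (Finsupp.single m 1) (m + scalarOpHeight k) ≠ 0 := by
  rw [Ne, scalarOp_single_apply_eq_zero_iff]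
  rcases Nat.even_or_odd' (k + 1) with ⟨s, hs | hs⟩
  · rw [hs, show m + scalarOpHeight k - 2 = m - s by unfold scalarOpHeight; omega]
    exact right_ne_zero_of_mul ((solveCoeff_high_pos k hm s).1 hs.ge).ne'
  · rw [hs, show m + scalarOpHeight k - 2 = m - s - 2 by unfold scalarOpHeight; omega]
    exact right_ne_zero_of_mul ((solveCoeff_high_pos k hm s).2 (by omega)).ne'

end Coefficients

/-- The operator `θ_{1/2} : Λ_{1/2} → Λ_{1/2}` is injective and its cokernel has complex
dimension `3(k′+1)`: `H^i_dR(𝔾_m, L ⊗ Sym^k Ai)` has dimension `3(k′+1)` for `i = 1` and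
vanishes for `i = 0`. -/
theorem stmt_16 (k k' : ℕ) (hk : 1 ≤ k) (hk' : k' = (k - 1) / 2) :
    LinearMap.ker (theta k (1 / 2)) = ⊥
    ∧ FiniteDimensional ℂ
        ((Fin (k + 1) → (ℤ →₀ ℂ)) ⧸ LinearMap.range (theta k (1 / 2)))
    ∧ Module.finrank ℂ
        ((Fin (k + 1) → (ℤ →₀ ℂ)) ⧸ LinearMap.range (theta k (1 / 2)))
        = 3 * (k' + 1) := by
  have hker := ker_eq_bot_of_band (scalarOp_single_low k) (scalarOp_single_low_ne_zero k)
  obtain ⟨hfin, hrank⟩ := finrank_coker_of_band (scalarOp_single_low k)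
    (scalarOp_single_low_ne_zero k) (fun m n h => scalarOp_single_high k m hk n h)
    (fun m hm => scalarOp_single_high_ne_zero k m hk hm)
  refine ⟨ker_theta_eq_bot k hk hker, Module.Finite.equiv (cokerEquiv k hk), ?_⟩
  rw [← (cokerEquiv k hk).finrank_eq, hrank, hk']
  unfold scalarOpHeight
  omega
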